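/- arXiv:1205.1356 — 2 statements merged into one kernel-verified Lean document; each statement's English description precedes it below -/
import Mathlib

section
/- Assume 1 < p < ∞ and μ(M) > 0. If f₀ is an extremal function for the p-modulus, then f₀(x) > 0 for μ-almost every x ∈ M. -/
open MeasureTheory ENNReal Filter

variable {M N : Type*}

/-- `f : M → [0,∞]` is `p`-admissible for a measurable set `S ⊆ N`:
`f` is measurable, `∫_M f^p dμ < ∞`, and `∫_M f dν_y ≥ 1` for `σ`-a.e. `y ∈ S`. -/
def IsAdmissible [MeasurableSpace M] [MeasurableSpace N]
    (μ : Measure M) (σ : Measure N) (ν : N → Measure M) (p : ℝ)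
    (S : Set N) (f : M → ℝ≥0∞) : Prop :=
  Measurable f ∧ (∫⁻ x, f x ^ p ∂μ) < ∞ ∧ ∀ᵐ y ∂σ, y ∈ S → 1 ≤ ∫⁻ x, f x ∂(ν y)

/-- The `p`-modulus of `S ⊆ N`: the infimum of `(∫_M f^p dμ)^{1/p}` over all
`p`-admissible `f` for `S` (`∞` if there is no admissible function). -/
noncomputable def Modulus [MeasurableSpace M] [MeasurableSpace N]
    (μ : Measure M) (σ : Measure N) (ν : N → Measure M) (p : ℝ) (S : Set N) : ℝ≥0∞ :=
  ⨅ (f : M → ℝ≥0∞) (_ : IsAdmissible μ σ ν p S f), (∫⁻ x, f x ^ p ∂μ) ^ (1 / p)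

/-- `f₀` is extremal for the `p`-modulus: admissible for all of `N`, realizing the modulus. -/
def IsExtremal [MeasurableSpace M] [MeasurableSpace N]
    (μ : Measure M) (σ : Measure N) (ν : N → Measure M) (p : ℝ)
    (f₀ : M → ℝ≥0∞) : Prop :=
  IsAdmissible μ σ ν p Set.univ f₀ ∧
    (∫⁻ x, f₀ x ^ p ∂μ) ^ (1 / p) = Modulus μ σ ν p Set.univ

/-- An extremal function minimizes the `p`-energy among admissible functions. -/
theorem IsExtremal.lintegral_rpow_le [MeasurableSpace M] [MeasurableSpace N]
    {μ : Measure M} {σ : Measure N} {ν : N → Measure M} {p : ℝ} (hp : 0 < p)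
    {f₀ f : M → ℝ≥0∞} (h₀ : IsExtremal μ σ ν p f₀) (hf : IsAdmissible μ σ ν p Set.univ f) :
    ∫⁻ x, f₀ x ^ p ∂μ ≤ ∫⁻ x, f x ^ p ∂μ := by
  have h : (∫⁻ x, f₀ x ^ p ∂μ) ^ (1 / p) ≤ (∫⁻ x, f x ^ p ∂μ) ^ (1 / p) :=
    h₀.2.trans_le (iInf₂_le f hf)
  exact (ENNReal.rpow_le_rpow_iff (by positivity)).1 h

/-- For `p > 1`, the term `ε ^ p * m` is eventually dominated by `ε * d` as `ε → 0`. -/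
theorem ENNReal.exists_rpow_mul_lt_mul {p : ℝ} (hp : 1 < p) {m d : ℝ≥0∞}
    (hm0 : m ≠ 0) (hm : m ≠ ∞) (hd0 : d ≠ 0) (hd : d ≠ ∞) :
    ∃ ε : ℝ≥0∞, ε ≠ 0 ∧ ε ≤ 1 ∧ ε ^ p * m < ε * d := by
  set δ : ℝ≥0∞ := min 1 (d / 2 / m) with hδ
  have hp' : 0 < p - 1 := sub_pos.2 hp
  have hδ0 : δ ≠ 0 := by
    have : 0 < d / 2 / m := ENNReal.div_pos (ENNReal.half_pos hd0).ne' hm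
    exact (lt_min one_pos this).ne'
  have hδ1 : δ ≤ 1 := min_le_left _ _
  have hε1 : δ ^ (1 / (p - 1)) ≤ 1 := ENNReal.rpow_le_one hδ1 (by positivity)
  have hε0 : δ ^ (1 / (p - 1)) ≠ 0 :=
    (ENNReal.rpow_pos (pos_iff_ne_zero.2 hδ0) (hδ1.trans_lt one_lt_top).ne).ne'
  have hεt : δ ^ (1 / (p - 1)) ≠ ∞ := (hε1.trans_lt one_lt_top).ne
  refine ⟨δ ^ (1 / (p - 1)), hε0, hε1, ?_⟩
  have hpow : (δ ^ (1 / (p - 1))) ^ p = δ ^ (1 / (p - 1)) * δ := by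
    conv_lhs => rw [show p = 1 + (p - 1) by ring, ENNReal.rpow_add _ _ (by simpa using hε0)
      (by simpa using hεt)]
    rw [ENNReal.rpow_one, add_sub_cancel_left, ← ENNReal.rpow_mul, one_div_mul_cancel hp'.ne',
      ENNReal.rpow_one]
  rw [hpow, mul_assoc]
  refine (ENNReal.mul_lt_mul_iff_right hε0 hεt).2 ?_
  calc δ * m ≤ d / 2 / m * m := by gcongr; exact min_le_right _ _
    _ = d / 2 := ENNReal.div_mul_cancel hm0 hm
    _ < d := ENNReal.half_lt_self hd0 hd

/-- Shrinking `a` by the factor `1 - s` lowers `a ^ p` by at least `s * a ^ p`. -/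
theorem ENNReal.one_sub_mul_rpow_add_le {p : ℝ} (hp : 1 ≤ p) {s : ℝ≥0∞} (hs : s ≤ 1)
    (a : ℝ≥0∞) : ((1 - s) * a) ^ p + s * a ^ p ≤ a ^ p := by
  have h1 : (1 - s) ^ p ≤ 1 - s := by
    simpa using ENNReal.rpow_le_rpow_of_exponent_ge (tsub_le_self : 1 - s ≤ 1) hp
  calc ((1 - s) * a) ^ p + s * a ^ p
      = ((1 - s) ^ p + s) * a ^ p := by
        rw [ENNReal.mul_rpow_of_nonneg _ _ (by linarith), add_mul]
    _ ≤ ((1 - s) + s) * a ^ p := by gcongr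
    _ = a ^ p := by rw [tsub_add_cancel_of_le hs, one_mul]

theorem statement_13
    {M N : Type*} [MeasurableSpace M] [MeasurableSpace N]
    (μ : Measure M) (σ : Measure N) [SigmaFinite μ] [SigmaFinite σ]
    (ν : N → Measure M) (hνsf : ∀ y, SigmaFinite (ν y))
    (hker : ∀ A : Set M, MeasurableSet A → Measurable fun y => ν y A)
    (p : ℝ) (hp : 1 < p)
    (π : M → N) (hπ : Measurable π)
    (hleaf : ∀ᵐ y ∂σ, ν y (Set.univ \ π ⁻¹' {y}) = 0)
    (J : M → ℝ≥0∞) (hJ : Measurable J) (hJ0 : ∀ x, 0 < J x) (hJtop : ∀ x, J x < ∞)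
    (hFubini : ∀ f : M → ℝ≥0∞, Measurable f →
      ∫⁻ x, f x ∂μ = ∫⁻ y, (∫⁻ x, f x / J x ∂(ν y)) ∂σ)
    (hμpos : 0 < μ Set.univ)
    (f₀ : M → ℝ≥0∞) (hf₀ : IsExtremal μ σ ν p f₀) :
    ∀ᵐ x ∂μ, 0 < f₀ x := by
  obtain ⟨hf₀m, hI, hadm⟩ := hf₀.1
  have hp0 : 0 < p := by linarith
  have hν : Measurable ν := Measure.measurable_of_measurable_coe _ hker
  have hνint : ∀ f : M → ℝ≥0∞, Measurable f → Measurable fun y => ∫⁻ x, f x ∂(ν y) :=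
    fun f hf => (Measure.measurable_lintegral hf).comp hν
  have hdiv : ∀ f : M → ℝ≥0∞, Measurable f → Measurable fun x => f x / J x :=
    fun f hf => hf.div hJ
  have hfib : ∀ᵐ y ∂σ, ∀ᵐ x ∂(ν y), π x = y := by
    filter_upwards [hleaf] with y hy
    rw [ae_iff]
    convert hy using 2
    ext x
    simp
  by_contra hneg
  have hZm : MeasurableSet {x | ¬ 0 < f₀ x} := (measurableSet_lt measurable_const hf₀m).compl
  obtain ⟨Z, hZ, hZsub, hZ0, hZt⟩ :=
    Measure.exists_subset_measure_lt_top hZm (pos_iff_ne_zero.2 fun h => hneg (ae_iff.2 h))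
  have hfZ : ∀ x ∈ Z, f₀ x = 0 := fun x hx => not_lt.1 (hZsub hx) |>.antisymm bot_le
  have hind : Measurable (Z.indicator (1 : M → ℝ≥0∞)) := measurable_one.indicator hZ
  set c : N → ℝ≥0∞ := fun y => min 1 (ν y Z) with hc
  have hcm : Measurable c := measurable_const.min (hker Z hZ)
  have hc1 : ∀ y, c y ≤ 1 := fun y => min_le_left _ _
  set d := ∫⁻ x, c (π x) * f₀ x ^ p ∂μ with hd
  have hGm : Measurable fun x => c (π x) * f₀ x ^ p := (hcm.comp hπ).mul (hf₀m.pow_const p)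
  have hdt : d ≠ ∞ := by
    refine ((lintegral_mono fun x => ?_).trans_lt hI).ne
    exact mul_le_of_le_one_left' (hc1 _)
  have hd0 : d ≠ 0 := by
    intro h0
    rw [hd, hFubini _ hGm, lintegral_eq_zero_iff (hνint _ (hdiv _ hGm))] at h0
    have hZν : ∀ᵐ y ∂σ, ν y Z = 0 := by
      filter_upwards [h0, hadm, hfib] with y hy hy1 hae
      by_contra hne
      have hcy : c y ≠ 0 := (lt_min one_pos (pos_iff_ne_zero.2 hne)).ne'
      have hz := (lintegral_eq_zero_iff (hdiv _ hGm)).1 hy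
      have hf : ∫⁻ x, f₀ x ∂(ν y) = 0 := by
        rw [lintegral_eq_zero_iff hf₀m]
        filter_upwards [hz, hae] with x hx hxy
        simp only [Pi.zero_apply, ENNReal.div_eq_zero_iff, mul_eq_zero, hxy, hcy, false_or,
          (hJtop x).ne, or_false] at hx
        exact (ENNReal.rpow_eq_zero_iff_of_pos hp0).1 hx
      have := hy1 (Set.mem_univ y)
      rw [hf] at this
      simp at this
    have hμZ : μ Z = 0 := by
      rw [← lintegral_indicator_one hZ, hFubini _ hind]
      rw [lintegral_eq_zero_iff (hνint _ (hdiv _ hind))]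
      filter_upwards [hZν] with y hy
      rw [Pi.zero_apply, lintegral_eq_zero_iff (hdiv _ hind)]
      filter_upwards [measure_eq_zero_iff_ae_notMem.1 hy] with x hx
      simp [hx]
    exact hZ0.ne' hμZ
  obtain ⟨ε, -, hε1, hε⟩ := ENNReal.exists_rpow_mul_lt_mul hp hZ0.ne' hZt.ne hd0 hdt
  have hεt : ε ≠ ∞ := (hε1.trans_lt one_lt_top).ne
  have hs1 : ∀ y, ε * c y ≤ 1 := fun y => mul_le_one' hε1 (hc1 y)
  set f : M → ℝ≥0∞ := fun x => (1 - ε * c (π x)) * f₀ x + ε * Z.indicator 1 x with hf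
  have hfm : Measurable f :=
    ((measurable_const.sub ((hcm.comp hπ).const_mul ε)).mul hf₀m).add (hind.const_mul ε)
  have hpt : ∀ x, f x ^ p + ε * (c (π x) * f₀ x ^ p) ≤
      f₀ x ^ p + ε ^ p * Z.indicator 1 x := by
    intro x
    by_cases hx : x ∈ Z
    · simp [hf, hx, hfZ x hx, hp0]
    · simpa [hf, hx, mul_assoc] using
        ENNReal.one_sub_mul_rpow_add_le hp.le (hs1 (π x)) (f₀ x)
  have hint : ∫⁻ x, f x ^ p ∂μ + ε * d ≤ ∫⁻ x, f₀ x ^ p ∂μ + ε ^ p * μ Z := by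
    calc ∫⁻ x, f x ^ p ∂μ + ε * d
        = ∫⁻ x, (f x ^ p + ε * (c (π x) * f₀ x ^ p)) ∂μ := by
          rw [lintegral_add_left (hfm.pow_const p), lintegral_const_mul _ hGm]
      _ ≤ ∫⁻ x, (f₀ x ^ p + ε ^ p * Z.indicator 1 x) ∂μ := lintegral_mono hpt
      _ = ∫⁻ x, f₀ x ^ p ∂μ + ε ^ p * μ Z := by
          rw [lintegral_add_left (hf₀m.pow_const p), lintegral_const_mul _ hind,
            lintegral_indicator_one hZ]
  have hadmf : IsAdmissible μ σ ν p Set.univ f := by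
    refine ⟨hfm, (le_self_add.trans hint).trans_lt (ENNReal.add_lt_top.2
      ⟨hI, ENNReal.mul_lt_top (ENNReal.rpow_lt_top_of_nonneg hp0.le hεt) hZt⟩), ?_⟩
    filter_upwards [hadm, hfib] with y hy1 hae _
    calc (1 : ℝ≥0∞) = (1 - ε * c y) + ε * c y := (tsub_add_cancel_of_le (hs1 y)).symm
      _ ≤ (1 - ε * c y) * ∫⁻ x, f₀ x ∂(ν y) + ε * ν y Z := by
          gcongr
          · exact le_mul_of_one_le_right' (hy1 (Set.mem_univ y))
          · exact min_le_right _ _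
      _ = ∫⁻ x, ((1 - ε * c y) * f₀ x + ε * Z.indicator 1 x) ∂(ν y) := by
          rw [lintegral_add_left (hf₀m.const_mul _), lintegral_const_mul _ hf₀m,
            lintegral_const_mul _ hind, lintegral_indicator_one hZ]
      _ = ∫⁻ x, f x ∂(ν y) := by
          refine lintegral_congr_ae ?_
          filter_upwards [hae] with x hx
          simp [hf, hx]
  have hle : ∫⁻ x, f₀ x ^ p ∂μ + ε * d ≤ ∫⁻ x, f₀ x ^ p ∂μ + ε ^ p * μ Z :=
    (add_le_add_left (hf₀.lintegral_rpow_le hp0 hadmf) _).trans hint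
  exact hε.not_ge ((ENNReal.add_le_add_iff_left hI.ne).1 hle)
end

section
/- Assume there exists an extremal function for the p-modulus. Then for every measurable φ : M → ℝ with ∫_M |φ|^p dμ < ∞ one has ∫_M |φ| dν_y < ∞ for σ-almost every y ∈ N. -/
open MeasureTheory ENNReal Filter

variable {M N : Type*}

/-- An extremal function vanishes `μ`-a.e. over a set `E` of leaves on each of which some
`p`-integrable function `g` has infinite integral: it can be replaced there by `ε * g`. -/
theorem IsExtremal.setLIntegral_rpow_eq_zero [MeasurableSpace M] [MeasurableSpace N]
    {μ : Measure M} {σ : Measure N} {ν : N → Measure M} {p : ℝ} (hp : 0 < p)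
    {π : M → N} (hπ : Measurable π) (hleaf : ∀ᵐ y ∂σ, ∀ᵐ x ∂(ν y), π x = y)
    {f₀ : M → ℝ≥0∞} (hf₀ : IsExtremal μ σ ν p f₀)
    {g : M → ℝ≥0∞} (hg : Measurable g) (hgp : (∫⁻ x, g x ^ p ∂μ) < ∞)
    {E : Set N} (hE : MeasurableSet E) (hgE : ∀ y ∈ E, ∫⁻ x, g x ∂(ν y) = ∞) :
    ∫⁻ x in π ⁻¹' E, f₀ x ^ p ∂μ = 0 := by
  classical
  obtain ⟨⟨hm, hfin, hadm⟩, hmin⟩ := hf₀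
  have hA : MeasurableSet (π ⁻¹' E) := hπ hE
  have hcompl : ∫⁻ x in (π ⁻¹' E)ᶜ, f₀ x ^ p ∂μ ≠ ∞ :=
    ((setLIntegral_le_lintegral _ _).trans_lt hfin).ne
  have key : ∀ δ : ℝ≥0∞, δ ≠ 0 → δ ≠ ∞ →
      ∫⁻ x in π ⁻¹' E, f₀ x ^ p ∂μ ≤ δ * ∫⁻ x, g x ^ p ∂μ := by
    intro δ hδ0 hδ
    set ε : ℝ≥0∞ := δ ^ (1 / p)
    have hε0 : ε ≠ 0 := by
      simp [ε, ENNReal.rpow_eq_zero_iff, hδ0, hδ]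
    have hεp : ε ^ p = δ := by
      simp only [ε]
      rw [← ENNReal.rpow_mul, one_div_mul_cancel hp.ne', ENNReal.rpow_one]
    set h : M → ℝ≥0∞ := (π ⁻¹' E).piecewise (fun x => ε * g x) f₀
    have hh : Measurable h := (hg.const_mul ε).piecewise hA hm
    have hsplit : ∫⁻ x, h x ^ p ∂μ =
        δ * ∫⁻ x in π ⁻¹' E, g x ^ p ∂μ + ∫⁻ x in (π ⁻¹' E)ᶜ, f₀ x ^ p ∂μ := by
      rw [← lintegral_add_compl _ hA, ← lintegral_const_mul _ (hg.pow_const p)]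
      congr 1
      · refine setLIntegral_congr_fun hA fun x hx => ?_
        simp only [h, Set.piecewise_eq_of_mem _ _ _ hx]
        rw [ENNReal.mul_rpow_of_nonneg _ _ hp.le, hεp]
      · refine setLIntegral_congr_fun hA.compl fun x hx => ?_
        simp only [h, Set.piecewise_eq_of_notMem _ _ _ hx]
    have hle : δ * ∫⁻ x in π ⁻¹' E, g x ^ p ∂μ ≤ δ * ∫⁻ x, g x ^ p ∂μ := by
      gcongr
      exact Measure.restrict_le_self
    have hhadm : IsAdmissible μ σ ν p Set.univ h := by
      refine ⟨hh, ?_, ?_⟩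
      · rw [hsplit]
        exact ENNReal.add_lt_top.2
          ⟨hle.trans_lt (ENNReal.mul_lt_top hδ.lt_top hgp), hcompl.lt_top⟩
      · filter_upwards [hleaf, hadm] with y hy hy1 _
        by_cases hyE : y ∈ E
        · have : ∫⁻ x, h x ∂(ν y) = ∫⁻ x, ε * g x ∂(ν y) := by
            refine lintegral_congr_ae ?_
            filter_upwards [hy] with x hx
            exact Set.piecewise_eq_of_mem _ _ _ (by simpa [hx] using hyE)
          rw [this, lintegral_const_mul _ hg, hgE y hyE, ENNReal.mul_top hε0]
          exact le_top
        · have : ∫⁻ x, h x ∂(ν y) = ∫⁻ x, f₀ x ∂(ν y) := by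
            refine lintegral_congr_ae ?_
            filter_upwards [hy] with x hx
            exact Set.piecewise_eq_of_notMem _ _ _ (by simpa [hx] using hyE)
          rw [this]
          exact hy1 trivial
    have hcmp : ∫⁻ x, f₀ x ^ p ∂μ ≤ ∫⁻ x, h x ^ p ∂μ := by
      rw [← ENNReal.rpow_le_rpow_iff (one_div_pos.2 hp), hmin]
      exact iInf₂_le h hhadm
    rw [hsplit, ← lintegral_add_compl _ hA] at hcmp
    exact ((ENNReal.add_le_add_iff_right hcompl).1 hcmp).trans hle
  have hlim : Tendsto (fun n : ℕ => (n : ℝ≥0∞)⁻¹ * ∫⁻ x, g x ^ p ∂μ) atTop (nhds 0) := by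
    simpa using ENNReal.Tendsto.mul_const ENNReal.tendsto_inv_nat_nhds_zero (Or.inr hgp.ne)
  refine le_antisymm (ge_of_tendsto hlim ?_) bot_le
  filter_upwards [eventually_ne_atTop 0] with n hn
  exact key _ (by simp) (by simpa using hn)

theorem statement_14
    {M N : Type*} [MeasurableSpace M] [MeasurableSpace N]
    (μ : Measure M) (σ : Measure N) [SigmaFinite μ] [SigmaFinite σ]
    (ν : N → Measure M) (hνsf : ∀ y, SigmaFinite (ν y))
    (hker : ∀ A : Set M, MeasurableSet A → Measurable fun y => ν y A)
    (p : ℝ) (hp : 1 ≤ p)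
    (π : M → N) (hπ : Measurable π)
    (hleaf : ∀ᵐ y ∂σ, ν y (Set.univ \ π ⁻¹' {y}) = 0)
    (J : M → ℝ≥0∞) (hJ : Measurable J) (hJ0 : ∀ x, 0 < J x) (hJtop : ∀ x, J x < ∞)
    (hFubini : ∀ f : M → ℝ≥0∞, Measurable f →
      ∫⁻ x, f x ∂μ = ∫⁻ y, (∫⁻ x, f x / J x ∂(ν y)) ∂σ)
    (hex : ∃ f₀ : M → ℝ≥0∞, IsExtremal μ σ ν p f₀)
    (φ : M → ℝ) (hφ : Measurable φ)
    (hφp : (∫⁻ x, ENNReal.ofReal |φ x| ^ p ∂μ) < ∞) :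
    ∀ᵐ y ∂σ, (∫⁻ x, ENNReal.ofReal |φ x| ∂(ν y)) < ∞ := by
  obtain ⟨f₀, hf₀⟩ := hex
  have hp0 : 0 < p := one_pos.trans_le hp
  have hg : Measurable fun x => ENNReal.ofReal |φ x| := hφ.abs.ennreal_ofReal
  have hν : Measurable ν := Measure.measurable_of_measurable_coe ν hker
  have hleaf' : ∀ᵐ y ∂σ, ∀ᵐ x ∂(ν y), π x = y := by
    filter_upwards [hleaf] with y hy
    rw [ae_iff]
    convert hy using 2
    ext x
    simp
  set E : Set N := {y | ∫⁻ x, ENNReal.ofReal |φ x| ∂(ν y) = ∞}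
  have hE : MeasurableSet E :=
    ((Measure.measurable_lintegral hg).comp hν) (measurableSet_singleton ∞)
  have hm : Measurable f₀ := hf₀.1.1
  have hzero := hf₀.setLIntegral_rpow_eq_zero hp0 hπ hleaf' hg hφp hE fun _ hy => hy
  have hF : Measurable ((π ⁻¹' E).indicator fun x => f₀ x ^ p) :=
    (hm.pow_const p).indicator (hπ hE)
  rw [← lintegral_indicator (hπ hE), hFubini _ hF] at hzero
  have hzero' := (lintegral_eq_zero_iff
    ((Measure.measurable_lintegral (hF.div hJ)).comp hν)).1 hzero
  filter_upwards [hzero', hleaf', hf₀.1.2.2] with y hy0 hyπ hy1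
  rw [lt_top_iff_ne_top]
  intro hyE
  have hf₀0 : ∫⁻ x, f₀ x ∂(ν y) = 0 := by
    rw [lintegral_eq_zero_iff hm]
    filter_upwards [(lintegral_eq_zero_iff (hF.div hJ)).1 hy0, hyπ] with x hx hxy
    have hxE : x ∈ π ⁻¹' E := by
      rw [Set.mem_preimage, hxy]
      exact hyE
    simpa [Set.indicator_of_mem hxE, ENNReal.div_eq_zero_iff, (hJtop x).ne,
      ENNReal.rpow_eq_zero_iff, hp0, hp0.not_gt] using hx
  simpa [hf₀0] using hy1 trivial
end
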